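/- (Convergence of the derivative weight before the hitting time.) Let x > 0, let f : [0,∞) → ℝ be continuous with f(0) = 0, and let t ≥ 0 satisfy t < τ^{x,f}. Suppose that for every a ∈ (0,1] the function x^a : [0,t] → (0,∞) is continuous and satisfies x^a(s) ≥ X^{x,f}(s) for all s ∈ [0,t]. Then lim_{a→0⁺} ∫_0^t (1/a)·(log φ)″(x^a(s)/√a) ds = 0; equivalently, the weights V^a_t = exp(∫_0^t (1/a)·(log φ)″(x^a(s)/√a) ds), which all lie in (0,1], converge to 1 as a → 0⁺. -/

import Mathlib

open MeasureTheory Filter Topology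
open scoped ENNReal

/-- The reflection (local time) term of the Skorohod problem:
`L^{x,f}(t) = sup_{s ∈ [0,t]} max (-(x + f s)) 0`. -/
noncomputable def skL (x : ℝ) (f : ℝ → ℝ) (t : ℝ) : ℝ :=
  sSup ((fun s => max (-(x + f s)) 0) '' Set.Icc 0 t)

/-- The reflected path `X^{x,f} = x + f + L^{x,f}`. -/
noncomputable def skX (x : ℝ) (f : ℝ → ℝ) (t : ℝ) : ℝ :=
  x + f t + skL x f t

/-- The first hitting time of `0` by `X^{x,f}`: `τ^{x,f} = inf {t > 0 : X^{x,f}(t) = 0}`,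
taken in `ℝ≥0∞` so that the infimum of the empty set is `∞`. -/
noncomputable def skTau (x : ℝ) (f : ℝ → ℝ) : ℝ≥0∞ :=
  ⨅ (t : ℝ) (_ : 0 < t) (_ : skX x f t = 0), ENNReal.ofReal t

/-- `φ(x) = ∫_0^x exp(-y²/2) dy`. -/
noncomputable def phi (x : ℝ) : ℝ := ∫ y in (0:ℝ)..x, Real.exp (-(y ^ 2) / 2)

theorem hasDerivAt_phi (z : ℝ) : HasDerivAt phi (Real.exp (-(z ^ 2) / 2)) z := by
  have hc : Continuous fun y : ℝ => Real.exp (-(y ^ 2) / 2) := by fun_prop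
  exact intervalIntegral.integral_hasDerivAt_right (hc.intervalIntegrable _ _)
    (hc.stronglyMeasurableAtFilter _ _) hc.continuousAt

theorem strictMono_phi : StrictMono phi :=
  strictMono_of_deriv_pos fun z => by
    rw [(hasDerivAt_phi z).deriv]
    exact Real.exp_pos _

theorem phi_pos {z : ℝ} (hz : 0 < z) : 0 < phi z := by
  simpa [phi] using strictMono_phi hz

theorem iteratedDeriv_two_log_phi {z : ℝ} (hz : 0 < z) :
    iteratedDeriv 2 (fun z => Real.log (phi z)) z =
      -(z * (Real.exp (-(z ^ 2) / 2) / phi z) + (Real.exp (-(z ^ 2) / 2) / phi z) ^ 2) := by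
  have hfirst : deriv (fun z => Real.log (phi z)) =ᶠ[𝓝 z]
      fun w => Real.exp (-(w ^ 2) / 2) / phi w := by
    filter_upwards [lt_mem_nhds hz] with w hw
    exact ((hasDerivAt_phi w).log (phi_pos hw).ne').deriv
  have hexp : HasDerivAt (fun w : ℝ => Real.exp (-(w ^ 2) / 2))
      (Real.exp (-(z ^ 2) / 2) * (-z)) z := by
    have h : HasDerivAt (fun w : ℝ => -(w ^ 2) / 2) (-z) z :=
      ((hasDerivAt_pow 2 z).fun_neg.div_const 2).congr_deriv (by norm_num; ring)
    exact h.exp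
  rw [iteratedDeriv_succ, iteratedDeriv_one, hfirst.deriv_eq,
    (hexp.fun_div (hasDerivAt_phi z) (phi_pos hz).ne').deriv]
  have := (phi_pos hz).ne'
  field_simp
  ring

theorem iteratedDeriv_two_log_phi_nonpos {z : ℝ} (hz : 0 < z) :
    iteratedDeriv 2 (fun z => Real.log (phi z)) z ≤ 0 := by
  have := phi_pos hz
  rw [iteratedDeriv_two_log_phi hz, neg_nonpos]
  positivity

theorem exp_neg_sq_div_two_le {w : ℝ} (hw : 0 < w) :
    Real.exp (-(w ^ 2) / 2) ≤ 48 / w ^ 6 := by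
  have h : (w ^ 2 / 2) ^ 3 / 6 ≤ Real.exp (w ^ 2 / 2) := by
    simpa [Nat.factorial] using Real.pow_div_factorial_le_exp (w ^ 2 / 2) (by positivity) 3
  rw [neg_div, Real.exp_neg, ← inv_div (w ^ 6) 48]
  refine inv_anti₀ (by positivity) (le_trans (le_of_eq ?_) h)
  ring

/-- The second logarithmic derivative of `phi` decays faster than `z ^ (-3)`. -/
theorem exists_abs_iteratedDeriv_two_log_phi_le :
    ∃ K : ℝ, 0 < K ∧ ∀ w : ℝ, 1 ≤ w →
      |iteratedDeriv 2 (fun z => Real.log (phi z)) w| ≤ K / w ^ 3 := by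
  have h1 : 0 < phi 1 := phi_pos one_pos
  refine ⟨48 / phi 1 + (48 / phi 1) ^ 2, by positivity, fun w hw => ?_⟩
  have hw0 : 0 < w := by linarith
  have hp : 0 < phi w := phi_pos hw0
  have hA : Real.exp (-(w ^ 2) / 2) / phi w ≤ 48 / phi 1 / w ^ 6 := by
    calc Real.exp (-(w ^ 2) / 2) / phi w ≤ (48 / w ^ 6) / phi 1 :=
          div_le_div₀ (by positivity) (exp_neg_sq_div_two_le hw0) h1
            (strictMono_phi.monotone hw)
      _ = 48 / phi 1 / w ^ 6 := div_right_comm _ _ _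
  have hA0 : 0 ≤ Real.exp (-(w ^ 2) / 2) / phi w := by positivity
  rw [iteratedDeriv_two_log_phi hw0, abs_neg, abs_of_nonneg (by positivity)]
  calc w * (Real.exp (-(w ^ 2) / 2) / phi w) + (Real.exp (-(w ^ 2) / 2) / phi w) ^ 2
      ≤ w * (48 / phi 1 / w ^ 6) + (48 / phi 1 / w ^ 6) ^ 2 := by gcongr
    _ = 48 / phi 1 / w ^ 5 + (48 / phi 1) ^ 2 / w ^ 12 := by field_simp
    _ ≤ 48 / phi 1 / w ^ 3 + (48 / phi 1) ^ 2 / w ^ 3 := by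
      gcongr <;> first | exact hw | norm_num
    _ = _ := by ring

theorem skL_nonneg (x : ℝ) (f : ℝ → ℝ) (t : ℝ) : 0 ≤ skL x f t :=
  Real.sSup_nonneg (by rintro _ ⟨s, -, rfl⟩; exact le_max_right _ _)

/-- Before the hitting time of zero the unreflected path is positive. -/
theorem add_pos_of_lt_skTau {x : ℝ} (hx : 0 < x) {f : ℝ → ℝ}
    (hf : ContinuousOn f (Set.Ici 0)) (hf0 : f 0 = 0) {t : ℝ}
    (htau : ENNReal.ofReal t < skTau x f) {s : ℝ} (hs : s ∈ Set.Icc 0 t) :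
    0 < x + f s := by
  by_contra! hneg
  have hc : ContinuousOn (fun u => x + f u) (Set.Ici 0) := continuousOn_const.add hf
  have exists_zero : ∀ v, 0 ≤ v → x + f v ≤ 0 → ∃ u ∈ Set.Icc 0 v, x + f u = 0 := by
    intro v hv hfv
    exact intermediate_value_Icc' hv (hc.mono Set.Icc_subset_Ici_self)
      ⟨hfv, by simpa [hf0] using hx.le⟩
  have hcompact : IsCompact (Set.Icc 0 s ∩ (fun u => x + f u) ⁻¹' {0}) :=
    isCompact_Icc.of_isClosed_subset
      ((hc.mono Set.Icc_subset_Ici_self).preimage_isClosed_of_isClosed isClosed_Icc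
        isClosed_singleton) Set.inter_subset_left
  obtain ⟨u₀, hu₀, hfu₀⟩ := exists_zero s hs.1 hneg
  obtain ⟨r, ⟨hr, hfr⟩, hmin⟩ := hcompact.exists_isLeast ⟨u₀, hu₀, hfu₀⟩
  have hfr : x + f r = 0 := hfr
  have hr0 : 0 < r := by
    refine lt_of_le_of_ne hr.1 ?_
    rintro rfl
    linarith
  have hnonneg : ∀ v ∈ Set.Icc 0 r, 0 ≤ x + f v := by
    intro v hv
    by_contra! hlt
    obtain ⟨u, hu, hfu⟩ := exists_zero v hv.1 hlt.le
    have hru : r ≤ u := hmin ⟨⟨hu.1, hu.2.trans (hv.2.trans hr.2)⟩, hfu⟩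
    have hvr : v = r := le_antisymm hv.2 (hru.trans hu.2)
    rw [hvr] at hlt
    linarith
  have hL : skL x f r = 0 := by
    refine le_antisymm (Real.sSup_nonpos ?_) (skL_nonneg x f r)
    rintro _ ⟨v, hv, rfl⟩
    exact max_le (by linarith [hnonneg v hv]) le_rfl
  have hX : skX x f r = 0 := by rw [skX, hfr, hL, add_zero]
  have hle : skTau x f ≤ ENNReal.ofReal r := iInf₂_le_of_le r hr0 (iInf_le _ hX)
  exact (htau.trans_le hle).not_ge (ENNReal.ofReal_le_ofReal (hr.2.trans hs.2))

theorem exists_pos_le_skX {x : ℝ} (hx : 0 < x) {f : ℝ → ℝ}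
    (hf : ContinuousOn f (Set.Ici 0)) (hf0 : f 0 = 0) {t : ℝ} (ht : 0 ≤ t)
    (htau : ENNReal.ofReal t < skTau x f) :
    ∃ c, 0 < c ∧ ∀ s ∈ Set.Icc 0 t, c ≤ skX x f s := by
  obtain ⟨m, hm, hmin⟩ := isCompact_Icc.exists_isMinOn (Set.nonempty_Icc.2 ht)
    (f := fun s => x + f s) (continuousOn_const.add (hf.mono Set.Icc_subset_Ici_self))
  refine ⟨x + f m, add_pos_of_lt_skTau hx hf hf0 htau hm, fun s hs => ?_⟩
  have hms : x + f m ≤ x + f s := hmin hs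
  have hL := skL_nonneg x f s
  rw [skX]
  linarith


/-- convergence of the derivative weight before the hitting time. If
`t < τ^{x,f}` and for each `a ∈ (0,1]` the continuous path `x^a` on `[0,t]` dominates
the Skorohod reflection `X^{x,f}`, then `∫_0^t (1/a)·(log φ)″(x^a(s)/√a) ds → 0` as
`a → 0⁺`; equivalently the weights `V^a_t = exp(∫_0^t (1/a)·(log φ)″(x^a(s)/√a) ds)`,
which all lie in `(0,1]`, converge to `1`. -/
theorem statement17 (x : ℝ) (hx : 0 < x) (f : ℝ → ℝ)
    (hf : ContinuousOn f (Set.Ici 0)) (hf0 : f 0 = 0)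
    (t : ℝ) (ht : 0 ≤ t) (htau : ENNReal.ofReal t < skTau x f)
    (xa : ℝ → ℝ → ℝ)
    (hcont : ∀ a ∈ Set.Ioc (0 : ℝ) 1, ContinuousOn (xa a) (Set.Icc 0 t))
    (hpos : ∀ a ∈ Set.Ioc (0 : ℝ) 1, ∀ s ∈ Set.Icc (0 : ℝ) t, 0 < xa a s)
    (hdom : ∀ a ∈ Set.Ioc (0 : ℝ) 1, ∀ s ∈ Set.Icc (0 : ℝ) t, skX x f s ≤ xa a s) :
    Tendsto (fun a => ∫ s in (0:ℝ)..t,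
        (1 / a) * iteratedDeriv 2 (fun z => Real.log (phi z)) (xa a s / Real.sqrt a))
      (nhdsWithin 0 (Set.Ioi 0)) (nhds 0) ∧
    (∀ a ∈ Set.Ioc (0 : ℝ) 1,
      Real.exp (∫ s in (0:ℝ)..t,
          (1 / a) * iteratedDeriv 2 (fun z => Real.log (phi z)) (xa a s / Real.sqrt a))
        ∈ Set.Ioc (0 : ℝ) 1) ∧
    Tendsto (fun a => Real.exp (∫ s in (0:ℝ)..t,
        (1 / a) * iteratedDeriv 2 (fun z => Real.log (phi z)) (xa a s / Real.sqrt a)))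
      (nhdsWithin 0 (Set.Ioi 0)) (nhds 1) := by
  have htend : Tendsto (fun a => ∫ s in (0:ℝ)..t,
      (1 / a) * iteratedDeriv 2 (fun z => Real.log (phi z)) (xa a s / Real.sqrt a))
      (nhdsWithin 0 (Set.Ioi 0)) (nhds 0) := by
    obtain ⟨c, hc, hcX⟩ := exists_pos_le_skX hx hf hf0 ht htau
    obtain ⟨K, hK, hbound⟩ := exists_abs_iteratedDeriv_two_log_phi_le
    have hlim : Tendsto (fun a : ℝ => K * √a / c ^ 3 * |t - 0|) (𝓝[>] 0) (𝓝 0) := by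
      have hcts : Continuous fun a : ℝ => K * √a / c ^ 3 * |t - 0| := by fun_prop
      simpa using (hcts.tendsto 0).mono_left nhdsWithin_le_nhds
    refine squeeze_zero_norm' ?_ hlim
    have hsmall : ∀ᶠ a : ℝ in 𝓝[>] 0, a < min (1 : ℝ) (c ^ 2) :=
      nhdsWithin_le_nhds (gt_mem_nhds (by positivity))
    filter_upwards [hsmall, self_mem_nhdsWithin] with a ha (ha0 : 0 < a)
    obtain ⟨ha1, hac⟩ := lt_min_iff.1 ha
    have hs0 : 0 < √a := Real.sqrt_pos.2 ha0
    refine intervalIntegral.norm_integral_le_of_norm_le_const fun s hs => ?_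
    rw [Set.uIoc_of_le ht] at hs
    have hs' := Set.Ioc_subset_Icc_self hs
    have hcxa : c ≤ xa a s := (hcX s hs').trans (hdom a ⟨ha0, ha1.le⟩ s hs')
    have hw : c / √a ≤ xa a s / √a := by gcongr
    have h1 : 1 ≤ c / √a := by
      rw [one_le_div hs0]
      exact Real.sqrt_le_iff.2 ⟨hc.le, hac.le⟩
    rw [norm_mul, Real.norm_eq_abs, Real.norm_eq_abs, abs_of_pos (by positivity)]
    calc 1 / a * |iteratedDeriv 2 (fun z => Real.log (phi z)) (xa a s / √a)|
        ≤ 1 / a * (K / (xa a s / √a) ^ 3) := by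
          gcongr
          exact hbound _ (h1.trans hw)
      _ ≤ 1 / a * (K / (c / √a) ^ 3) := by gcongr
      _ = 1 / √a ^ 2 * (K / (c / √a) ^ 3) := by rw [Real.sq_sqrt ha0.le]
      _ = K * √a / c ^ 3 := by field_simp
  refine ⟨htend, fun a ha => ⟨Real.exp_pos _, Real.exp_le_one_iff.2 ?_⟩, ?_⟩
  · rw [intervalIntegral.integral_of_le ht]
    refine setIntegral_nonpos measurableSet_Ioc fun s hs => ?_
    have ha0 : 0 < a := ha.1
    exact mul_nonpos_of_nonneg_of_nonpos (by positivity)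
      (iteratedDeriv_two_log_phi_nonpos (div_pos (hpos a ha s (Set.Ioc_subset_Icc_self hs))
        (Real.sqrt_pos.2 ha0)))
  · have hexp := (Real.continuous_exp.tendsto 0).comp htend
    rw [Real.exp_zero] at hexp
    exact hexp
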